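/- For every n ≥ 0: (a) F = {u : V_* → ℝ : u∘F_w restricted to V^{𝒍ⁿ}_* belongs to F^{𝒍ⁿ} for every w ∈ W_n}; (b) for all u,v ∈ F, E(u,v) = (1/R_n) ∑_{w∈W_n} E^{𝒍ⁿ}(u∘F_w|_{V^{𝒍ⁿ}_*}, v∘F_w|_{V^{𝒍ⁿ}_*}). -/

import Mathlib

open scoped BigOperators ENNReal
open Set Filter MeasureTheory

noncomputable section

abbrev E2 : Type := EuclideanSpace ℝ (Fin 2)

/-- The index set `S_l` of the level-`l` thin Sierpinski gasket. -/
def Sset (l : ℕ) : Set (ℕ × ℕ) :=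
  {p | p.1 + p.2 ≤ l - 1 ∧ p.1 * p.2 * (l - 1 - p.1 - p.2) = 0}

/-- The contraction `f^l_i`. -/
def fmap (q : Fin 3 → E2) (l : ℕ) (i : ℕ × ℕ) (x : E2) : E2 :=
  q 0 + ((i.1 : ℝ) / l) • (q 1 - q 0) + ((i.2 : ℝ) / l) • (q 2 - q 0)
    + (l : ℝ)⁻¹ • (x - q 0)

/-- The closed equilateral triangle `△`. -/
def Tri (q : Fin 3 → E2) : Set E2 := convexHull ℝ (Set.range q)

def V0 (q : Fin 3 → E2) : Set E2 := Set.range q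

/-- Words of length `n` (padded by `(0,0)` beyond position `n`). -/
def Wn (l : ℕ → ℕ) (n : ℕ) : Set (ℕ → ℕ × ℕ) :=
  {w | (∀ k, k < n → w k ∈ Sset (l k)) ∧ ∀ k, n ≤ k → w k = (0, 0)}

/-- `wordMap q l w n = f^{l_1}_{w_1} ∘ ⋯ ∘ f^{l_n}_{w_n}` (0-indexed). -/
def wordMap (q : Fin 3 → E2) (l : ℕ → ℕ) (w : ℕ → ℕ × ℕ) : ℕ → E2 → E2
  | 0 => id
  | n + 1 => wordMap q l w n ∘ fmap q (l n) (w n)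

/-- The thin scale irregular Sierpinski gasket `K`. -/
def Gasket (q : Fin 3 → E2) (l : ℕ → ℕ) : Set E2 :=
  ⋂ n, ⋃ w ∈ Wn l n, wordMap q l w n '' Tri q

/-- The cell `K_w = K ∩ f_w(△)`. -/
def Cell (q : Fin 3 → E2) (l : ℕ → ℕ) (n : ℕ) (w : ℕ → ℕ × ℕ) : Set E2 :=
  Gasket q l ∩ wordMap q l w n '' Tri q

def Vn (q : Fin 3 → E2) (l : ℕ → ℕ) (n : ℕ) : Set E2 :=
  ⋃ w ∈ Wn l n, wordMap q l w n '' V0 q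

def Vstar (q : Fin 3 → E2) (l : ℕ → ℕ) : Set E2 := ⋃ n, Vn q l n

def Ln (l : ℕ → ℕ) (n : ℕ) : ℕ := ∏ k ∈ Finset.range n, l k

def Mn (l : ℕ → ℕ) (n : ℕ) : ℕ := ∏ k ∈ Finset.range n, (3 * l k - 3)

def rl (l : ℕ) : ℝ := (2 * (l : ℝ) / 3 + 1 / 9)⁻¹

def Rn (l : ℕ → ℕ) (n : ℕ) : ℝ := ∏ k ∈ Finset.range n, rl (l k)

def Tn (l : ℕ → ℕ) (n : ℕ) : ℝ := (Mn l n : ℝ) / Rn l n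

/-- The basic energy form `E⁰` on `ℝ^{V₀}`. -/
def E0 (q : Fin 3 → E2) (u v : E2 → ℝ) : ℝ :=
  (1 / 2) * ∑ j : Fin 3, ∑ k : Fin 3, (u (q j) - u (q k)) * (v (q j) - v (q k))

/-- The level-`n` energy form `Eⁿ`. -/
def En (q : Fin 3 → E2) (l : ℕ → ℕ) (n : ℕ) (u v : E2 → ℝ) : ℝ :=
  (Rn l n)⁻¹ * ∑ᶠ w ∈ Wn l n, E0 q (u ∘ wordMap q l w n) (v ∘ wordMap q l w n)

/-- The domain `F` of the limit resistance form. -/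
def FDom (q : Fin 3 → E2) (l : ℕ → ℕ) : Set (E2 → ℝ) :=
  {u | ∃ C : ℝ, ∀ n, En q l n u u ≤ C}

/-- The limit form `E(u,v) = lim_n Eⁿ(u,v)`. -/
def EForm (q : Fin 3 → E2) (l : ℕ → ℕ) (u v : E2 → ℝ) : ℝ :=
  limUnder atTop fun n => En q l n u v

/-- The intrinsic (geodesic) distance on `K`, with values in `ℝ≥0∞`. -/
def pdist (q : Fin 3 → E2) (l : ℕ → ℕ) (x y : E2) : ℝ≥0∞ :=
  ⨅ (γ : ℝ → E2) (_ : ContinuousOn γ (Set.Icc 0 1))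
    (_ : Set.MapsTo γ (Set.Icc 0 1) (Gasket q l)) (_ : γ 0 = x) (_ : γ 1 = y),
    eVariationOn γ (Set.Icc 0 1)

def gdist (q : Fin 3 → E2) (l : ℕ → ℕ) (x y : E2) : ℝ := (pdist q l x y).toReal

/-- The set of resistance quotients used to define `R_E`. -/
def REset (q : Fin 3 → E2) (l : ℕ → ℕ) (x y : E2) : Set ℝ :=
  {t | ∃ u ∈ FDom q l, 0 < EForm q l u u ∧ t = (u x - u y) ^ 2 / EForm q l u u}

/-- The resistance metric `R_E`. -/
def RE (q : Fin 3 → E2) (l : ℕ → ℕ) (x y : E2) : ℝ := sSup (REset q l x y)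

/-- Resistance quotients over continuous representatives (i.e. `F` viewed in `C(K)`). -/
def REcSet (q : Fin 3 → E2) (l : ℕ → ℕ) (x y : E2) : Set ℝ :=
  {t | ∃ u ∈ FDom q l, ContinuousOn u (Gasket q l) ∧ 0 < EForm q l u u ∧
    t = (u x - u y) ^ 2 / EForm q l u u}

def REc (q : Fin 3 → E2) (l : ℕ → ℕ) (x y : E2) : ℝ := sSup (REcSet q l x y)

/-- The open `d`-ball in `K`. -/
def Bd (q : Fin 3 → E2) (l : ℕ → ℕ) (x : E2) (s : ℝ) : Set E2 :=
  {y ∈ Gasket q l | gdist q l x y < s}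

/-- The open `R_E`-ball in `K`. -/
def BRc (q : Fin 3 → E2) (l : ℕ → ℕ) (x : E2) (s : ℝ) : Set E2 :=
  {y ∈ Gasket q l | REc q l x y < s}

/-- `Λ^{(k)}_{n,w}`: words within `k` cell-steps of `w`. -/
def Lam (q : Fin 3 → E2) (l : ℕ → ℕ) (n : ℕ) (w : ℕ → ℕ × ℕ) (k : ℕ) :
    Set (ℕ → ℕ × ℕ) :=
  {v ∈ Wn l n | ∃ c : ℕ → ℕ → ℕ × ℕ, c 0 = w ∧ c k = v ∧ (∀ j ≤ k, c j ∈ Wn l n) ∧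
    ∀ j < k, (Cell q l n (c j) ∩ Cell q l n (c (j + 1))).Nonempty}

/-- `U^{(k)}_{n,w}`. -/
def Unwk (q : Fin 3 → E2) (l : ℕ → ℕ) (n : ℕ) (w : ℕ → ℕ × ℕ) (k : ℕ) : Set E2 :=
  ⋃ v ∈ Lam q l n w k, Cell q l n v

def betaZero (l : ℕ → ℕ) : ℝ :=
  ⨅ n : ℕ, Real.logb (l n) (2 * (l n : ℝ) ^ 2 - (5 / 3) * (l n : ℝ) - 1 / 3)

def betaOne (l : ℕ → ℕ) : ℝ :=
  ⨆ n : ℕ, Real.logb (l n) (2 * (l n : ℝ) ^ 2 - (5 / 3) * (l n : ℝ) - 1 / 3)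

def betaM (l : ℕ → ℕ) : ℝ := ⨅ n : ℕ, Real.logb (l n) (3 * (l n : ℝ) - 3)

def betaR (l : ℕ → ℕ) : ℝ := ⨆ n : ℕ, Real.logb (l n) ((rl (l n))⁻¹)

/-- The value of `Ψ` on the interval `[1/L_{n+1}, 1/L_n]`. -/
def psiPiece (l : ℕ → ℕ) (n : ℕ) (s : ℝ) : ℝ :=
  (Tn l (n + 1))⁻¹
    * (1 + ((3 * (l n : ℝ) - 4) / ((l n : ℝ) - 1)) * ((Ln l (n + 1) : ℝ) * s - 1))
    * (1 + (((2 / 3) * (l n : ℝ) - 8 / 9) / ((l n : ℝ) - 1)) * ((Ln l (n + 1) : ℝ) * s - 1))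

/-- `Ψ = Ψ_𝒍` is characterized by these defining clauses. -/
def IsPsi (l : ℕ → ℕ) (Psi : ℝ → ℝ) : Prop :=
  (∀ n : ℕ, ∀ s : ℝ, ((Ln l (n + 1) : ℝ))⁻¹ ≤ s → s ≤ ((Ln l n : ℝ))⁻¹ →
      Psi s = psiPiece l n s) ∧
  (∀ s : ℝ, 1 ≤ s → Psi s = s ^ betaZero l) ∧ Psi 0 = 0

def psiMPiece (l : ℕ → ℕ) (n : ℕ) (s : ℝ) : ℝ :=
  ((Mn l (n + 1) : ℝ))⁻¹
    * (1 + ((3 * (l n : ℝ) - 4) / ((l n : ℝ) - 1)) * ((Ln l (n + 1) : ℝ) * s - 1))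

def IsPsiM (l : ℕ → ℕ) (PsiM : ℝ → ℝ) : Prop :=
  (∀ n : ℕ, ∀ s : ℝ, ((Ln l (n + 1) : ℝ))⁻¹ ≤ s → s ≤ ((Ln l n : ℝ))⁻¹ →
      PsiM s = psiMPiece l n s) ∧
  (∀ s : ℝ, 1 ≤ s → PsiM s = s ^ betaM l) ∧ PsiM 0 = 0

def psiRPiece (l : ℕ → ℕ) (n : ℕ) (s : ℝ) : ℝ :=
  Rn l (n + 1)
    * (1 + (((2 / 3) * (l n : ℝ) - 8 / 9) / ((l n : ℝ) - 1)) * ((Ln l (n + 1) : ℝ) * s - 1))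

def IsPsiR (l : ℕ → ℕ) (PsiR : ℝ → ℝ) : Prop :=
  (∀ n : ℕ, ∀ s : ℝ, ((Ln l (n + 1) : ℝ))⁻¹ ≤ s → s ≤ ((Ln l n : ℝ))⁻¹ →
      PsiR s = psiRPiece l n s) ∧
  (∀ s : ℝ, 1 ≤ s → PsiR s = s ^ betaR l) ∧ PsiR 0 = 0

/-- `μ` is the uniform distribution on `K`: a Borel measure carried by `K`
with `μ(K_w) = 1/M_{|w|}` for every word `w`. -/
def IsUnif (q : Fin 3 → E2) (l : ℕ → ℕ) (μ : Measure E2) : Prop :=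
  μ (Gasket q l)ᶜ = 0 ∧ ∀ n : ℕ, ∀ w ∈ Wn l n, μ (Cell q l n w) = ((Mn l n : ℝ≥0∞))⁻¹

/-- `μ` is the energy measure of `u`: a Borel measure carried by `K` with
`μ(K_w) = R_{|w|}⁻¹ E^{𝒍^{|w|}}(u∘F_w, u∘F_w)` for every word `w`. -/
def IsEnergyMeasure (q : Fin 3 → E2) (l : ℕ → ℕ) (u : E2 → ℝ) (μ : Measure E2) : Prop :=
  μ (Gasket q l)ᶜ = 0 ∧ ∀ n : ℕ, ∀ w ∈ Wn l n,
    μ (Cell q l n w) = ENNReal.ofReal ((Rn l n)⁻¹ *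
      EForm q (fun k => l (k + n)) (u ∘ wordMap q l w n) (u ∘ wordMap q l w n))



/-! ### Helper lemmas -/

lemma Sset_finite (l : ℕ) : (Sset l).Finite := by
  apply Set.Finite.subset ((Set.finite_Iic (l - 1)).prod (Set.finite_Iic (l - 1)))
  rintro ⟨a, b⟩ ⟨h, -⟩
  simp only [Set.mem_prod, Set.mem_Iic] at h ⊢
  omega

lemma Wn_finite (l : ℕ → ℕ) (n : ℕ) : (Wn l n).Finite := by
  induction n with
  | zero =>
    apply Set.Finite.subset (Set.finite_singleton (fun _ => ((0 : ℕ), (0 : ℕ))))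
    rintro w ⟨-, h⟩
    exact funext fun k => h k (Nat.zero_le k)
  | succ n ih =>
    apply Set.Finite.subset ((ih.prod (Sset_finite (l n))).image
      (fun p => Function.update p.1 n p.2))
    rintro w ⟨h1, h2⟩
    refine ⟨(Function.update w n (0, 0), w n), ⟨⟨?_, ?_⟩, h1 n (Nat.lt_succ_self n)⟩, ?_⟩
    · intro k hk
      simp only [Function.update_of_ne hk.ne]
      exact h1 k (by omega)
    · intro k hk
      rcases eq_or_ne k n with rfl | hne
      · simp
      · simp only [Function.update_of_ne hne]
        exact h2 k (by omega)
    · simp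

lemma wordMap_congr (q : Fin 3 → E2) (l : ℕ → ℕ) (w w' : ℕ → ℕ × ℕ) (n : ℕ)
    (h : ∀ k, k < n → w k = w' k) : wordMap q l w n = wordMap q l w' n := by
  induction n with
  | zero => rfl
  | succ n ih =>
    simp only [wordMap]
    rw [ih (fun k hk => h k (by omega)), h n (by omega)]

lemma wordMap_add (q : Fin 3 → E2) (l : ℕ → ℕ) (w : ℕ → ℕ × ℕ) (n m : ℕ) :
    wordMap q l w (n + m) =
      wordMap q l w n ∘ wordMap q (fun k => l (k + n)) (fun k => w (k + n)) m := by
  induction m with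
  | zero => rfl
  | succ m ih =>
    rw [← Nat.add_assoc]
    simp only [wordMap]
    rw [ih, Function.comp_assoc, Nat.add_comm m n]

/-- Concatenation of words. -/
def concatW (n : ℕ) (w w' : ℕ → ℕ × ℕ) : ℕ → ℕ × ℕ :=
  fun k => if k < n then w k else w' (k - n)

lemma wordMap_concat (q : Fin 3 → E2) (l : ℕ → ℕ) (w w' : ℕ → ℕ × ℕ) (n m : ℕ) :
    wordMap q l (concatW n w w') (n + m) =
      wordMap q l w n ∘ wordMap q (fun k => l (k + n)) w' m := by
  rw [wordMap_add]
  congr 1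
  · apply wordMap_congr
    intro k hk
    simp [concatW, hk]
  · apply wordMap_congr
    intro k _
    simp [concatW]

lemma sum_Wn_add (l : ℕ → ℕ) (n m : ℕ) (g : (ℕ → ℕ × ℕ) → ℝ) :
    ∑ w ∈ (Wn_finite l (n + m)).toFinset, g w =
      ∑ w ∈ (Wn_finite l n).toFinset,
        ∑ w' ∈ (Wn_finite (fun k => l (k + n)) m).toFinset, g (concatW n w w') := by
  rw [← Finset.sum_product']
  symm
  apply Finset.sum_bij (fun p _ => concatW n p.1 p.2)
  · rintro ⟨w, w'⟩ h
    simp only [Finset.mem_product, Set.Finite.mem_toFinset] at h ⊢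
    obtain ⟨⟨h1, h2⟩, h3, h4⟩ := h
    refine ⟨fun k hk => ?_, fun k hk => ?_⟩
    · by_cases hkn : k < n
      · simp only [concatW, hkn, if_true]
        exact h1 k hkn
      · simp only [concatW, hkn, if_false]
        have := h3 (k - n) (by omega)
        simp only [show k - n + n = k by omega] at this
        exact this
    · have hkn : ¬ k < n := by omega
      simp only [concatW, hkn, if_false]
      exact h4 _ (by omega)
  · rintro ⟨w, w'⟩ h ⟨v, v'⟩ h' heq
    simp only [Finset.mem_product, Set.Finite.mem_toFinset] at h h'
    simp only [Prod.mk.injEq]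
    constructor
    · funext k
      by_cases hkn : k < n
      · have := congrFun heq k
        simpa [concatW, hkn] using this
      · rw [h.1.2 k (by omega), h'.1.2 k (by omega)]
    · funext k
      have := congrFun heq (k + n)
      simpa [concatW] using this
  · intro w h
    simp only [Set.Finite.mem_toFinset] at h
    obtain ⟨h1, h2⟩ := h
    refine ⟨(fun k => if k < n then w k else (0, 0), fun k => w (k + n)), ?_, ?_⟩
    · simp only [Finset.mem_product, Set.Finite.mem_toFinset]
      refine ⟨⟨fun k hk => ?_, fun k hk => ?_⟩, fun k hk => ?_, fun k hk => ?_⟩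
      · simp only [hk, if_true]
        exact h1 k (by omega)
      · simp only [show ¬ k < n by omega, if_false]
      · exact h1 (k + n) (by omega)
      · exact h2 (k + n) (by omega)
    · funext k
      by_cases hkn : k < n
      · simp [concatW, hkn]
      · simp only [concatW, hkn, if_false]
        rw [show k - n + n = k by omega]
  · intro p _
    rfl

lemma En_eq (q : Fin 3 → E2) (l : ℕ → ℕ) (n : ℕ) (u v : E2 → ℝ) :
    En q l n u v = (Rn l n)⁻¹ * ∑ w ∈ (Wn_finite l n).toFinset,
      E0 q (u ∘ wordMap q l w n) (v ∘ wordMap q l w n) := by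
  rw [En, finsum_mem_eq_finite_toFinset_sum _ (Wn_finite l n)]

lemma rl_pos (l : ℕ) : 0 < rl l := by
  unfold rl
  positivity

lemma Rn_pos (l : ℕ → ℕ) (n : ℕ) : 0 < Rn l n :=
  Finset.prod_pos fun _ _ => rl_pos _

lemma Rn_add (l : ℕ → ℕ) (n m : ℕ) :
    Rn l (n + m) = Rn l n * Rn (fun k => l (k + n)) m := by
  simp only [Rn, Finset.prod_range_add]
  simp only [Nat.add_comm n]

lemma En_add (q : Fin 3 → E2) (l : ℕ → ℕ) (n m : ℕ) (u v : E2 → ℝ) :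
    En q l (n + m) u v = (Rn l n)⁻¹ * ∑ w ∈ (Wn_finite l n).toFinset,
      En q (fun k => l (k + n)) m (u ∘ wordMap q l w n) (v ∘ wordMap q l w n) := by
  simp only [En_eq]
  rw [sum_Wn_add, Rn_add, mul_inv, mul_assoc, ← Finset.mul_sum]
  simp only [wordMap_concat, Function.comp_assoc]

lemma E0_expand (q : Fin 3 → E2) (u : E2 → ℝ) :
    E0 q u u = (u (q 0) - u (q 1)) ^ 2 + (u (q 1) - u (q 2)) ^ 2 + (u (q 2) - u (q 0)) ^ 2 := by
  simp only [E0, Fin.sum_univ_three]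
  ring

lemma E0_nonneg (q : Fin 3 → E2) (u : E2 → ℝ) : 0 ≤ E0 q u u := by
  rw [E0_expand]
  positivity

lemma En_nonneg (q : Fin 3 → E2) (l : ℕ → ℕ) (n : ℕ) (u : E2 → ℝ) : 0 ≤ En q l n u u := by
  rw [En_eq]
  exact mul_nonneg (inv_nonneg.2 (Rn_pos l n).le)
    (Finset.sum_nonneg fun _ _ => E0_nonneg _ _)

lemma En_polar (q : Fin 3 → E2) (l : ℕ → ℕ) (n : ℕ) (u v : E2 → ℝ) :
    En q l n u v = (En q l n (u + v) (u + v) - En q l n u u - En q l n v v) / 2 := by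
  simp only [En_eq]
  rw [← mul_sub, ← mul_sub, ← Finset.sum_sub_distrib, ← Finset.sum_sub_distrib, mul_div_assoc,
    Finset.sum_div]
  congr 1
  apply Finset.sum_congr rfl
  intro w _
  simp only [E0, Fin.sum_univ_three, Function.comp_apply, Pi.add_apply]
  ring

lemma En_add_le (q : Fin 3 → E2) (l : ℕ → ℕ) (n : ℕ) (u v : E2 → ℝ) :
    En q l n (u + v) (u + v) ≤ 2 * En q l n u u + 2 * En q l n v v := by
  have h : 2 * En q l n u u + 2 * En q l n v v
      = En q l n (u + v) (u + v) + En q l n (u - v) (u - v) := by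
    simp only [En_eq]
    rw [mul_left_comm, mul_left_comm 2, ← mul_add, ← mul_add,
      ← Finset.sum_add_distrib, ← mul_add, ← Finset.sum_add_distrib, Finset.mul_sum]
    congr 1
    apply Finset.sum_congr rfl
    intro w _
    simp only [E0, Fin.sum_univ_three, Function.comp_apply, Pi.add_apply, Pi.sub_apply]
    ring
  linarith [En_nonneg q l n (u - v)]

/-! ### The renormalization inequality -/

/-- Triangle energy. -/
def tE (a b c : ℝ) : ℝ := (a - b) ^ 2 + (b - c) ^ 2 + (c - a) ^ 2

lemma tE_nonneg (a b c : ℝ) : 0 ≤ tE a b c := by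
  unfold tE
  positivity

lemma tE_corner (q a b x y c : ℝ) :
    (3 / 5) * tE q a b ≤ tE q x y + tE x a c + tE y c b := by
  unfold tE
  nlinarith [sq_nonneg ((x - (2 * q + 2 * a + b) / 5) - (y - (2 * q + 2 * b + a) / 5)),
    sq_nonneg ((x - (2 * q + 2 * a + b) / 5) - (c - (2 * a + 2 * b + q) / 5)),
    sq_nonneg ((y - (2 * q + 2 * b + a) / 5) - (c - (2 * a + 2 * b + q) / 5)),
    sq_nonneg (x - (2 * q + 2 * a + b) / 5), sq_nonneg (y - (2 * q + 2 * b + a) / 5),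
    sq_nonneg (c - (2 * a + 2 * b + q) / 5)]

lemma tE_edge (a b c : ℝ) : (3 / 2) * (a - b) ^ 2 ≤ tE a b c := by
  unfold tE
  nlinarith [sq_nonneg ((b - c) - (c - a))]

/-- Titu inequality for two resistors in series. -/
lemma series2 (r s x y : ℝ) (hr : 0 < r) (hs : 0 < s) :
    (x + y) ^ 2 / (r + s) ≤ x ^ 2 / r + y ^ 2 / s := by
  rw [div_add_div _ _ hr.ne' hs.ne', div_le_div_iff₀ (by positivity) (by positivity)]
  have : 0 ≤ (s * x - r * y) ^ 2 := sq_nonneg _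
  nlinarith

lemma chain_le (p t : ℕ → ℝ) (m : ℕ) (hm : 0 < m) :
    (p 0 - p m) ^ 2 / ((2 / 3) * m) ≤ ∑ j ∈ Finset.range m, tE (p j) (p (j + 1)) (t j) := by
  induction m, hm using Nat.le_induction with
  | base =>
    simp only [Finset.sum_range_one]
    have := tE_edge (p 0) (p 1) (t 0)
    norm_num
    linarith
  | succ m hm ih =>
    rw [Finset.sum_range_succ]
    have h1 := tE_edge (p m) (p (m + 1)) (t m)
    have hm' : (0 : ℝ) < m := by exact_mod_cast hm
    have h2 := series2 ((2 / 3) * m) (2 / 3) (p 0 - p m) (p m - p (m + 1)) (by positivity)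
      (by norm_num)
    have e : (2 / 3 : ℝ) * ((m + 1 : ℕ) : ℝ) = (2 / 3) * m + 2 / 3 := by
      push_cast
      ring
    rw [e]
    have e2 : p 0 - p m + (p m - p (m + 1)) = p 0 - p (m + 1) := by ring
    rw [e2] at h2
    have e3 : (p m - p (m + 1)) ^ 2 / (2 / 3) = (3 / 2) * (p m - p (m + 1)) ^ 2 := by ring
    linarith

/-- The final network inequality. -/
lemma network (M q0 q1 q2 a01 a02 a10 a12 a20 a21 : ℝ) (hM : 0 < M) :
    tE q0 q1 q2 / ((2 / 3) * M + 25 / 9) ≤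
      (3 / 5) * tE q0 a01 a02 + (3 / 5) * tE q1 a12 a10 + (3 / 5) * tE q2 a20 a21
      + (a01 - a10) ^ 2 / ((2 / 3) * M) + (a12 - a21) ^ 2 / ((2 / 3) * M)
      + (a20 - a02) ^ 2 / ((2 / 3) * M) := by
  have star : ∀ a b c : ℝ, (3 / 5) * tE a b c = (a - (a + b + c) / 3) ^ 2 / (5 / 9)
      + (b - (a + b + c) / 3) ^ 2 / (5 / 9) + (c - (a + b + c) / 3) ^ 2 / (5 / 9) := by
    intro a b c
    unfold tE
    ring
  rw [star q0, star q1, star q2]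
  generalize (q0 + a01 + a02) / 3 = y0
  generalize (q1 + a12 + a10) / 3 = y1
  generalize (q2 + a20 + a21) / 3 = y2
  have side : ∀ a b y z : ℝ, (y - z) ^ 2 / ((2 / 3) * M + 10 / 9) ≤
      (a - y) ^ 2 / (5 / 9) + (a - b) ^ 2 / ((2 / 3) * M) + (b - z) ^ 2 / (5 / 9) := by
    intro a b y z
    have h1 := series2 (5 / 9) ((2 / 3) * M) (y - a) (a - b) (by norm_num) (by positivity)
    have h2 := series2 (5 / 9 + (2 / 3) * M) (5 / 9) (y - a + (a - b)) (b - z) (by positivity)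
      (by norm_num)
    rw [show y - a + (a - b) + (b - z) = y - z by ring,
      show 5 / 9 + (2 / 3) * M + 5 / 9 = (2 / 3) * M + 10 / 9 by ring] at h2
    have e : (y - a) ^ 2 = (a - y) ^ 2 := by ring
    rw [e] at h1
    linarith
  have s1 := side a01 a10 y0 y1
  have s2 := side a12 a21 y1 y2
  have s3 := side a20 a02 y2 y0
  set s : ℝ := (2 / 3) * M + 10 / 9 with hs
  have hs0 : 0 < s := by positivity
  have dstar : (y0 - y1) ^ 2 / s + (y1 - y2) ^ 2 / s + (y2 - y0) ^ 2 / s =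
      (y0 - (y0 + y1 + y2) / 3) ^ 2 / (s / 3) + (y1 - (y0 + y1 + y2) / 3) ^ 2 / (s / 3)
      + (y2 - (y0 + y1 + y2) / 3) ^ 2 / (s / 3) := by
    field_simp
    ring
  generalize (y0 + y1 + y2) / 3 = z at dstar
  have t0 := series2 (5 / 9) (s / 3) (q0 - y0) (y0 - z) (by norm_num) (by positivity)
  have t1 := series2 (5 / 9) (s / 3) (q1 - y1) (y1 - z) (by norm_num) (by positivity)
  have t2 := series2 (5 / 9) (s / 3) (q2 - y2) (y2 - z) (by norm_num) (by positivity)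
  rw [sub_add_sub_cancel] at t0 t1 t2
  have fin : tE q0 q1 q2 / ((2 / 3) * M + 25 / 9) ≤
      (q0 - z) ^ 2 / (5 / 9 + s / 3) + (q1 - z) ^ 2 / (5 / 9 + s / 3)
        + (q2 - z) ^ 2 / (5 / 9 + s / 3) := by
    rw [← add_div, ← add_div, show (2 / 3) * M + 25 / 9 = 3 * (5 / 9 + s / 3) by rw [hs]; ring,
      ← div_div]
    apply div_le_div_of_nonneg_right _ (by positivity)
    unfold tE
    nlinarith [sq_nonneg ((q0 - z) + (q1 - z) + (q2 - z))]
  linarith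

/-- Sum over the cells on the three sides. -/
lemma sides_le (m : ℕ) (g : ℕ × ℕ → ℝ) (hg : ∀ i, 0 ≤ g i) :
    (∑ k ∈ Finset.range (m + 3), g (k, 0)) + (∑ k ∈ Finset.range (m + 3), g (m + 3 - k, k))
      + (∑ k ∈ Finset.range (m + 3), g (0, m + 3 - k)) ≤
    ∑ i ∈ (Sset_finite (m + 4)).toFinset, g i := by
  classical
  set A := (Finset.range (m + 3)).image (fun k => (k, (0 : ℕ))) with hA
  set B := (Finset.range (m + 3)).image (fun k => (m + 3 - k, k)) with hB
  set C := (Finset.range (m + 3)).image (fun k => ((0 : ℕ), m + 3 - k)) with hC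
  have eA : ∑ i ∈ A, g i = ∑ k ∈ Finset.range (m + 3), g (k, 0) := by
    apply Finset.sum_image
    intro a ha b hb h
    simp only [Prod.mk.injEq, Finset.coe_range, Set.mem_Iio] at *
    omega
  have eB : ∑ i ∈ B, g i = ∑ k ∈ Finset.range (m + 3), g (m + 3 - k, k) := by
    apply Finset.sum_image
    intro a ha b hb h
    simp only [Prod.mk.injEq, Finset.coe_range, Set.mem_Iio] at *
    omega
  have eC : ∑ i ∈ C, g i = ∑ k ∈ Finset.range (m + 3), g (0, m + 3 - k) := by
    apply Finset.sum_image
    intro a ha b hb h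
    simp only [Prod.mk.injEq, Finset.coe_range, Set.mem_Iio, true_and] at *
    omega
  have dAB : Disjoint A B := by
    rw [Finset.disjoint_left]
    rintro ⟨x, y⟩ h1 h2
    simp only [hA, hB, Finset.mem_image, Finset.mem_range, Prod.mk.injEq] at h1 h2
    omega
  have dABC : Disjoint (A ∪ B) C := by
    rw [Finset.disjoint_left]
    rintro ⟨x, y⟩ h1 h2
    simp only [hA, hB, hC, Finset.mem_union, Finset.mem_image, Finset.mem_range,
      Prod.mk.injEq] at h1 h2
    omega
  rw [← eA, ← eB, ← eC, ← Finset.sum_union dAB, ← Finset.sum_union dABC]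
  apply Finset.sum_le_sum_of_subset_of_nonneg
  · rintro ⟨x, y⟩ h
    simp only [hA, hB, hC, Finset.mem_union, Finset.mem_image, Finset.mem_range,
      Prod.mk.injEq] at h
    simp only [Set.Finite.mem_toFinset, Sset, Set.mem_ofPred_eq, mul_eq_zero]
    rcases h with (⟨k, h1, h2, h3⟩ | ⟨k, h1, h2, h3⟩) | ⟨k, h1, h2, h3⟩ <;> omega
  · intro i _ _
    exact hg i

/-- The combinatorial renormalization inequality. -/
lemma renorm (m : ℕ) (hm : 0 < m) (G : ℕ × ℕ → ℝ) :
    tE (G (0, 0)) (G (m + 4, 0)) (G (0, m + 4)) / ((2 / 3) * m + 25 / 9) ≤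
    ∑ i ∈ (Sset_finite (m + 4)).toFinset,
      tE (G i) (G (i.1 + 1, i.2)) (G (i.1, i.2 + 1)) := by
  have hS := sides_le m (fun i => tE (G i) (G (i.1 + 1, i.2)) (G (i.1, i.2 + 1)))
    (fun i => tE_nonneg _ _ _)
  refine le_trans ?_ hS
  have split : ∀ f : ℕ → ℝ, ∑ k ∈ Finset.range (m + 3), f k =
      f 0 + f 1 + (∑ j ∈ Finset.range m, f (j + 2)) + f (m + 2) := by
    intro f
    rw [Finset.sum_range_succ, Finset.sum_range_succ', Finset.sum_range_succ']
    ring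
  rw [split, split, split]
  have c0 := tE_corner (G (0, 0)) (G (2, 0)) (G (0, 2)) (G (1, 0)) (G (0, 1)) (G (1, 1))
  have c1 := tE_corner (G (m + 4, 0)) (G (m + 2, 2)) (G (m + 2, 0)) (G (m + 3, 1)) (G (m + 3, 0))
    (G (m + 2, 1))
  have c2 := tE_corner (G (0, m + 4)) (G (0, m + 2)) (G (2, m + 2)) (G (0, m + 3)) (G (1, m + 3))
    (G (1, m + 2))
  have h0 := chain_le (fun j => G (j + 2, 0)) (fun j => G (j + 2, 1)) m hm
  have h1 := chain_le (fun j => G (m + 2 - j, j + 2)) (fun j => G (m + 1 - j, j + 2)) m hm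
  have h2 := chain_le (fun j => G (0, m + 2 - j)) (fun j => G (1, m + 1 - j)) m hm
  have N := network m (G (0, 0)) (G (m + 4, 0)) (G (0, m + 4)) (G (2, 0)) (G (0, 2))
    (G (m + 2, 0)) (G (m + 2, 2)) (G (0, m + 2)) (G (2, m + 2)) (by exact_mod_cast hm)
  have k1 : ∑ j ∈ Finset.range m,
        tE (G (m + 2 - j, j + 2)) (G (m + 2 - (j + 1), j + 1 + 2)) (G (m + 1 - j, j + 2))
      = ∑ j ∈ Finset.range m, tE (G (m + 3 - (j + 2), j + 2)) (G (m + 3 - (j + 2) + 1, j + 2))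
          (G (m + 3 - (j + 2), j + 2 + 1)) := by
    apply Finset.sum_congr rfl
    intro j hj
    rw [Finset.mem_range] at hj
    rw [show m + 3 - (j + 2) = m + 1 - j by omega, show m + 2 - (j + 1) = m + 1 - j by omega,
      show m + 1 - j + 1 = m + 2 - j by omega]
    unfold tE
    ring
  have k2 : ∑ j ∈ Finset.range m,
        tE (G (0, m + 2 - j)) (G (0, m + 2 - (j + 1))) (G (1, m + 1 - j))
      = ∑ j ∈ Finset.range m, tE (G (0, m + 3 - (j + 2))) (G (0 + 1, m + 3 - (j + 2)))
          (G (0, m + 3 - (j + 2) + 1)) := by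
    apply Finset.sum_congr rfl
    intro j hj
    rw [Finset.mem_range] at hj
    rw [show m + 3 - (j + 2) = m + 1 - j by omega, show m + 2 - (j + 1) = m + 1 - j by omega,
      show m + 1 - j + 1 = m + 2 - j by omega]
    unfold tE
    ring
  have k0 : ∑ j ∈ Finset.range m, tE (G (j + 2, 0)) (G (j + 1 + 2, 0)) (G (j + 2, 1))
      = ∑ j ∈ Finset.range m, tE (G (j + 2, 0)) (G (j + 2 + 1, 0)) (G (j + 2, 0 + 1)) := by
    rfl
  beta_reduce at h0 h1 h2 ⊢
  rw [k0] at h0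
  rw [k1] at h1
  rw [k2] at h2
  dsimp only at h0 h1 h2 ⊢
  rw [show m + 2 - m = 2 by omega] at h1 h2
  simp only [show m + 3 - (m + 2) = 1 by omega, show m + 3 - 1 = m + 2 by omega,
    Nat.sub_zero, Nat.zero_add, Nat.add_assoc, Nat.reduceAdd] at h0 h1 h2 ⊢
  refine N.trans ?_
  unfold tE at *
  linarith

lemma E0_le_En_one (q : Fin 3 → E2) (l : ℕ → ℕ) (hl : 5 ≤ l 0) (u : E2 → ℝ) :
    E0 q u u ≤ En q l 1 u u := by
  obtain ⟨m, hm, hm0⟩ : ∃ m, l 0 = m + 4 ∧ 0 < m := ⟨l 0 - 4, by omega, by omega⟩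
  have hR : Rn l 1 = rl (m + 4) := by simp [Rn, hm]
  set G : ℕ × ℕ → ℝ := fun i => u (q 0 + ((i.1 : ℝ) / ((m + 4 : ℕ) : ℝ)) • (q 1 - q 0)
    + ((i.2 : ℝ) / ((m + 4 : ℕ) : ℝ)) • (q 2 - q 0)) with hG
  have hsum : ∑ w ∈ (Wn_finite l 1).toFinset, E0 q (u ∘ wordMap q l w 1) (u ∘ wordMap q l w 1)
      = ∑ i ∈ (Sset_finite (m + 4)).toFinset,
        tE (G i) (G (i.1 + 1, i.2)) (G (i.1, i.2 + 1)) := by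
    apply Finset.sum_bij (fun w _ => w 0)
    · intro w hw
      simp only [Set.Finite.mem_toFinset] at hw ⊢
      rw [← hm]
      exact hw.1 0 (by omega)
    · intro w hw w' hw' h
      simp only [Set.Finite.mem_toFinset] at hw hw'
      funext k
      rcases Nat.eq_zero_or_pos k with rfl | hk
      · exact h
      · rw [hw.2 k hk, hw'.2 k hk]
    · intro i hi
      refine ⟨fun k => if k = 0 then i else (0, 0), ?_, by simp⟩
      simp only [Set.Finite.mem_toFinset] at hi ⊢
      refine ⟨fun k hk => ?_, fun k hk => ?_⟩
      · obtain rfl : k = 0 := by omega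
        simp only [if_true]
        rw [hm]
        exact hi
      · simp [show k ≠ 0 by omega]
    · intro w _
      rw [E0_expand]
      simp only [wordMap, Function.comp_apply, id, hm, fmap, hG, tE, sub_self, smul_zero, add_zero]
      have e1 : q 0 + (((w 0).1 : ℝ) / ((m + 4 : ℕ) : ℝ)) • (q 1 - q 0)
          + (((w 0).2 : ℝ) / ((m + 4 : ℕ) : ℝ)) • (q 2 - q 0)
          + (((m + 4 : ℕ) : ℝ))⁻¹ • (q 1 - q 0)
          = q 0 + ((((w 0).1 + 1 : ℕ) : ℝ) / ((m + 4 : ℕ) : ℝ)) • (q 1 - q 0)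
          + (((w 0).2 : ℝ) / ((m + 4 : ℕ) : ℝ)) • (q 2 - q 0) := by
        rw [Nat.cast_add (w 0).1, Nat.cast_one, add_div, one_div, add_smul]
        abel
      have e2 : q 0 + (((w 0).1 : ℝ) / ((m + 4 : ℕ) : ℝ)) • (q 1 - q 0)
          + (((w 0).2 : ℝ) / ((m + 4 : ℕ) : ℝ)) • (q 2 - q 0)
          + (((m + 4 : ℕ) : ℝ))⁻¹ • (q 2 - q 0)
          = q 0 + (((w 0).1 : ℝ) / ((m + 4 : ℕ) : ℝ)) • (q 1 - q 0)
          + ((((w 0).2 + 1 : ℕ) : ℝ) / ((m + 4 : ℕ) : ℝ)) • (q 2 - q 0) := by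
        rw [Nat.cast_add (w 0).2, Nat.cast_one, add_div, one_div, add_smul]
        abel
      rw [e1, e2]
  have hN : ((m + 4 : ℕ) : ℝ) ≠ 0 := by positivity
  have g0 : G (0, 0) = u (q 0) := by simp [hG]
  have g1 : G (m + 4, 0) = u (q 1) := by
    simp only [hG, div_self hN]
    simp
  have g2 : G (0, m + 4) = u (q 2) := by
    simp only [hG, div_self hN]
    simp
  have key := renorm m hm0 G
  rw [En_eq, hsum, hR, E0_expand]
  rw [g0, g1, g2, div_le_iff₀ (by positivity)] at key
  have hr : (rl (m + 4))⁻¹ = (2 / 3) * m + 25 / 9 := by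
    rw [rl, inv_inv]
    push_cast
    ring
  rw [hr, mul_comm]
  exact key

lemma En_mono (q : Fin 3 → E2) (l : ℕ → ℕ) (hl : ∀ n, 5 ≤ l n) (u : E2 → ℝ) :
    Monotone fun n => En q l n u u := by
  apply monotone_nat_of_le_succ
  intro n
  rw [En_add, En_eq]
  apply mul_le_mul_of_nonneg_left _ (inv_nonneg.2 (Rn_pos l n).le)
  apply Finset.sum_le_sum
  intro w _
  exact E0_le_En_one q (fun k => l (k + n)) (hl _) _

lemma FDom_add (q : Fin 3 → E2) (l : ℕ → ℕ) (u v : E2 → ℝ) (hu : u ∈ FDom q l)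
    (hv : v ∈ FDom q l) : u + v ∈ FDom q l := by
  obtain ⟨C, hC⟩ := hu
  obtain ⟨D, hD⟩ := hv
  refine ⟨2 * C + 2 * D, fun n => ?_⟩
  linarith [En_add_le q l n u v, hC n, hD n]

lemma En_tendsto_diag (q : Fin 3 → E2) (l : ℕ → ℕ) (hl : ∀ n, 5 ≤ l n) (u : E2 → ℝ)
    (hu : u ∈ FDom q l) : ∃ a, Tendsto (fun n => En q l n u u) atTop (nhds a) := by
  obtain ⟨C, hC⟩ := hu
  refine ⟨_, tendsto_atTop_ciSup (En_mono q l hl u) ⟨C, ?_⟩⟩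
  rintro _ ⟨n, rfl⟩
  exact hC n

lemma En_tendsto (q : Fin 3 → E2) (l : ℕ → ℕ) (hl : ∀ n, 5 ≤ l n) (u v : E2 → ℝ)
    (hu : u ∈ FDom q l) (hv : v ∈ FDom q l) :
    Tendsto (fun n => En q l n u v) atTop (nhds (EForm q l u v)) := by
  apply tendsto_nhds_limUnder
  obtain ⟨a, ha⟩ := En_tendsto_diag q l hl _ (FDom_add q l u v hu hv)
  obtain ⟨b, hb⟩ := En_tendsto_diag q l hl u hu
  obtain ⟨c, hc⟩ := En_tendsto_diag q l hl v hv
  refine ⟨(a - b - c) / 2, ?_⟩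
  simp only [En_polar q l _ u v]
  exact ((ha.sub hb).sub hc).div_const 2

lemma FDom_selfsim (q : Fin 3 → E2) (l : ℕ → ℕ) (hl : ∀ n, 5 ≤ l n) (n : ℕ) (u : E2 → ℝ) :
    u ∈ FDom q l ↔ ∀ w ∈ Wn l n, (u ∘ wordMap q l w n) ∈ FDom q (fun k => l (k + n)) := by
  constructor
  · rintro ⟨C, hC⟩ w hw
    refine ⟨Rn l n * C, fun m => ?_⟩
    have h := hC (n + m)
    rw [En_add, inv_mul_le_iff₀ (Rn_pos l n)] at h
    refine le_trans ?_ h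
    exact Finset.single_le_sum
      (f := fun w => En q (fun k => l (k + n)) m (u ∘ wordMap q l w n) (u ∘ wordMap q l w n))
      (fun w _ => En_nonneg q _ m _) ((Wn_finite l n).mem_toFinset.2 hw)
  · intro h
    choose! C hC using h
    refine ⟨(Rn l n)⁻¹ * ∑ w ∈ (Wn_finite l n).toFinset, C w, fun m => ?_⟩
    refine (En_mono q l hl u (Nat.le_add_left m n)).trans ?_
    dsimp only
    rw [En_add]
    apply mul_le_mul_of_nonneg_left _ (inv_nonneg.2 (Rn_pos l n).le)
    apply Finset.sum_le_sum
    intro w hw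
    exact hC w ((Wn_finite l n).mem_toFinset.1 hw) m

/-- (Non-exact) self-similarity of `(E,F)`:
`F = {u : u∘F_w ∈ F^{𝒍ⁿ} for all w ∈ W_n}` and
`E(u,v) = R_n⁻¹ ∑_{w∈W_n} E^{𝒍ⁿ}(u∘F_w, v∘F_w)`. -/
theorem stmt5 (q : Fin 3 → E2) (hq : ∀ j k : Fin 3, j ≠ k → dist (q j) (q k) = 1)
    (l : ℕ → ℕ) (hl : ∀ n, 5 ≤ l n) (n : ℕ) :
    (FDom q l = {u : E2 → ℝ | ∀ w ∈ Wn l n,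
        (u ∘ wordMap q l w n) ∈ FDom q (fun k => l (k + n))}) ∧
    (∀ u ∈ FDom q l, ∀ v ∈ FDom q l,
      EForm q l u v = (Rn l n)⁻¹ * ∑ᶠ w ∈ Wn l n,
        EForm q (fun k => l (k + n)) (u ∘ wordMap q l w n) (v ∘ wordMap q l w n)) := by
  refine ⟨Set.ext fun u => FDom_selfsim q l hl n u, ?_⟩
  intro u hu v hv
  have h1 := (En_tendsto q l hl u v hu hv).comp (tendsto_add_atTop_nat n)
  refine tendsto_nhds_unique h1 ?_
  rw [finsum_mem_eq_finite_toFinset_sum _ (Wn_finite l n)]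
  have h2 : ((fun m => En q l m u v) ∘ fun a => a + n) = fun m => (Rn l n)⁻¹ *
      ∑ w ∈ (Wn_finite l n).toFinset,
        En q (fun k => l (k + n)) m (u ∘ wordMap q l w n) (v ∘ wordMap q l w n) := by
    funext m
    simp only [Function.comp_apply]
    rw [Nat.add_comm, En_add]
  rw [h2]
  apply Tendsto.const_mul
  apply tendsto_finsetSum
  intro w hw
  have hw' := (Wn_finite l n).mem_toFinset.1 hw
  exact En_tendsto q _ (fun k => hl _) _ _ ((FDom_selfsim q l hl n u).1 hu w hw')
    ((FDom_selfsim q l hl n v).1 hv w hw')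

end
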